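/- Let P, Q : ℝ³ → ℝ be harmonic homogeneous polynomials of the same degree n ≥ 1. Then ∫_{S²} ∇P(x) · ((2n+1) Q(x) x − ∇Q(x)) dσ(x) = 0, where S² is the unit sphere in ℝ³ and σ is the 2-dimensional surface (Hausdorff) measure on S². (This expresses the orthogonality in L²(S²)³ of the boundary fields 𝐌ⁿ_m and 𝐍ⁿ⁺¹_m.) -/

import Mathlib

open MeasureTheory Real
open scoped RealInnerProductSpace

noncomputable section

/-- Three-dimensional Euclidean space. -/
abbrev E3 : Type := EuclideanSpace ℝ (Fin 3)

/-- Build an element of `E3` from coordinates. -/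
def toE3 (v : Fin 3 → ℝ) : E3 := (WithLp.equiv 2 (Fin 3 → ℝ)).symm v

/-- Partial derivative in the `i`-th coordinate direction. -/
def pd (f : E3 → ℝ) (i : Fin 3) (x : E3) : ℝ :=
  fderiv ℝ f x (EuclideanSpace.single i 1)

/-- The gradient, as the vector of partial derivatives. -/
def grad3 (f : E3 → ℝ) (x : E3) : E3 := toE3 fun i => pd f i x

/-- The Laplacian: the sum of the second partial derivatives. -/
def lap3 (f : E3 → ℝ) (x : E3) : ℝ := ∑ i, pd (pd f i) i x

/-- Divergence of a vector field. -/
def div3 (u : E3 → E3) (x : E3) : ℝ := ∑ i, pd (fun y => u y i) i x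

/-- Componentwise Laplacian of a vector field. -/
def vlap3 (u : E3 → E3) (x : E3) : E3 := toE3 fun i => lap3 (fun y => u y i) x

/-- Cross product in `ℝ³`. -/
def cross3 (u v : E3) : E3 :=
  toE3 ![u 1 * v 2 - u 2 * v 1, u 2 * v 0 - u 0 * v 2, u 0 * v 1 - u 1 * v 0]

/-- The function `ℝ³ → ℝ` determined by a polynomial in three variables. -/
def polyFun (P : MvPolynomial (Fin 3) ℝ) : E3 → ℝ :=
  fun x => MvPolynomial.eval (fun i => x i) P

open MvPolynomial

theorem pderiv_pderiv_comm (i j : Fin 3) (P : MvPolynomial (Fin 3) ℝ) :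
    pderiv i (pderiv j P) = pderiv j (pderiv i P) := by
  have h : ⁅(pderiv i : Derivation ℝ (MvPolynomial (Fin 3) ℝ) (MvPolynomial (Fin 3) ℝ)),
      (pderiv j : Derivation ℝ (MvPolynomial (Fin 3) ℝ) (MvPolynomial (Fin 3) ℝ))⁆ = 0 := by
    refine derivation_ext fun k => ?_
    simp [Derivation.commutator_apply, pderiv_X, Pi.single_apply, apply_ite]
  have h' := DFunLike.congr_fun h P
  simpa [Derivation.commutator_apply, sub_eq_zero] using h'

theorem hasFDerivAt_polyFun (P : MvPolynomial (Fin 3) ℝ) (x : E3) :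
    HasFDerivAt (polyFun P)
      (∑ i, polyFun (pderiv i P) x • (EuclideanSpace.proj i : E3 →L[ℝ] ℝ)) x := by
  induction P using MvPolynomial.induction_on with
  | C a =>
    convert! hasFDerivAt_const (𝕜 := ℝ) a x using 1
    · ext y; simp [polyFun]
    · simp [polyFun]
  | add p q hp hq =>
    convert! hp.add hq using 1
    · ext y; simp [polyFun]
    · simp [polyFun, add_smul, Finset.sum_add_distrib]
  | mul_X p k hp =>
    have hX : HasFDerivAt (fun y : E3 => y k) (EuclideanSpace.proj k : E3 →L[ℝ] ℝ) x :=
      (EuclideanSpace.proj k : E3 →L[ℝ] ℝ).hasFDerivAt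
    convert! hp.mul hX using 1
    · ext y; simp [polyFun]
    · ext v
      fin_cases k <;> simp [polyFun, Fin.sum_univ_three, pderiv_X] <;> ring

theorem continuous_polyFun (P : MvPolynomial (Fin 3) ℝ) : Continuous (polyFun P) :=
  continuous_iff_continuousAt.2 fun x => (hasFDerivAt_polyFun P x).continuousAt

theorem pd_polyFun (P : MvPolynomial (Fin 3) ℝ) (i : Fin 3) :
    pd (polyFun P) i = polyFun (pderiv i P) := by
  ext x
  rw [pd, (hasFDerivAt_polyFun P x).fderiv]
  fin_cases i <;> simp [Fin.sum_univ_three]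

theorem sum_sq_eq_one_of_mem_sphere {x : E3} (hx : x ∈ Metric.sphere (0 : E3) 1) :
    x 0 ^ 2 + x 1 ^ 2 + x 2 ^ 2 = 1 := by
  have h : ‖x‖ = 1 := by simpa using hx
  have h' := EuclideanSpace.real_norm_sq_eq x
  rw [h, Fin.sum_univ_three] at h'
  linarith

/-- The surface measure of the unit sphere is finite. -/
theorem hausdorffMeasure_sphere_lt_top : μH[2] (Metric.sphere (0 : E3) 1) < ⊤ := by
  let F : (Fin 2 → ℝ) → E3 := fun p =>
    toE3 ![sin (p 0) * cos (p 1), sin (p 0) * sin (p 1), cos (p 0)]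
  let K : Set (Fin 2 → ℝ) := Set.Icc (fun _ => -π) (fun _ => π)
  have hF : ContDiff ℝ 1 F := by
    refine contDiff_euclidean.2 fun i => ?_
    fin_cases i <;> simp [F, toE3] <;> fun_prop
  obtain ⟨C, hC⟩ := hF.contDiffOn.exists_lipschitzOnWith (s := K) one_ne_zero
    (convex_Icc _ _) isCompact_Icc
  have hsub : Metric.sphere (0 : E3) 1 ⊆ F '' K := by
    intro x hx
    have hx1 := sum_sq_eq_one_of_mem_sphere hx
    let z : ℂ := ⟨x 0, x 1⟩
    have hz : sin (arccos (x 2)) = ‖z‖ := by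
      rw [sin_arccos, Complex.norm_def, Complex.normSq_mk]
      congr 1
      linarith
    refine ⟨![arccos (x 2), z.arg], ⟨fun i => ?_, fun i => ?_⟩, ?_⟩
    · fin_cases i
      · simpa using by linarith [arccos_nonneg (x 2), pi_pos]
      · simpa using z.neg_pi_lt_arg.le
    · fin_cases i
      · simpa using arccos_le_pi _
      · simpa using z.arg_le_pi
    · ext i
      fin_cases i
      · change sin (arccos (x 2)) * cos z.arg = z.re
        rw [hz, Complex.norm_mul_cos_arg]
      · change sin (arccos (x 2)) * sin z.arg = z.im
        rw [hz, Complex.norm_mul_sin_arg]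
      · simpa [F, toE3] using cos_arccos (by nlinarith [sq_nonneg (x 0), sq_nonneg (x 1)])
          (by nlinarith [sq_nonneg (x 0), sq_nonneg (x 1)])
  have hvol : (μH[2] : Measure (Fin 2 → ℝ)) = volume := by
    simpa using hausdorffMeasure_pi_real (ι := Fin 2)
  calc μH[2] (Metric.sphere (0 : E3) 1) ≤ μH[2] (F '' K) := measure_mono hsub
    _ ≤ (C : ENNReal) ^ (2 : ℝ) * μH[2] K := hC.hausdorffMeasure_image_le zero_le_two
    _ < ⊤ := by
      rw [hvol]
      exact ENNReal.mul_lt_top (ENNReal.rpow_lt_top_of_nonneg zero_le_two ENNReal.coe_ne_top)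
        isCompact_Icc.measure_lt_top

/-- Rotation by the angle `t` in the oriented plane of the coordinates `i` and `j`. -/
def planeRotation (i j : Fin 3) (t : ℝ) : E3 →ₗ[ℝ] E3 where
  toFun v := toE3 fun k =>
    if k = i then cos t * v i - sin t * v j
    else if k = j then sin t * v i + cos t * v j
    else v k
  map_add' v w := by
    ext k
    simp only [toE3, WithLp.equiv_symm_apply, PiLp.add_apply]
    split_ifs <;> ring
  map_smul' c v := by
    ext k
    simp only [toE3, WithLp.equiv_symm_apply, PiLp.smul_apply, smul_eq_mul, RingHom.id_apply]
    split_ifs <;> ring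

theorem planeRotation_apply (i j : Fin 3) (t : ℝ) (v : E3) (k : Fin 3) :
    planeRotation i j t v k = if k = i then cos t * v i - sin t * v j
      else if k = j then sin t * v i + cos t * v j else v k := rfl

theorem planeRotation_zero (i j : Fin 3) (v : E3) : planeRotation i j 0 v = v := by
  ext k
  simp only [planeRotation_apply, cos_zero, sin_zero]
  split_ifs with h₁ h₂ <;> simp [*]

theorem norm_planeRotation {i j : Fin 3} (hij : i ≠ j) (t : ℝ) (v : E3) :
    ‖planeRotation i j t v‖ = ‖v‖ := by
  rw [← sq_eq_sq₀ (norm_nonneg _) (norm_nonneg _), EuclideanSpace.real_norm_sq_eq,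
    EuclideanSpace.real_norm_sq_eq, Fin.sum_univ_three, Fin.sum_univ_three]
  have h := sin_sq_add_cos_sq t
  simp only [planeRotation_apply]
  fin_cases i <;> fin_cases j <;> simp at hij ⊢
  · linear_combination (v 0 ^ 2 + v 1 ^ 2) * h
  · linear_combination (v 0 ^ 2 + v 2 ^ 2) * h
  · linear_combination (v 0 ^ 2 + v 1 ^ 2) * h
  · linear_combination (v 1 ^ 2 + v 2 ^ 2) * h
  · linear_combination (v 0 ^ 2 + v 2 ^ 2) * h
  · linear_combination (v 1 ^ 2 + v 2 ^ 2) * h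

/-- `planeRotation` as a linear isometry equivalence. -/
def planeRotationEquiv {i j : Fin 3} (hij : i ≠ j) (t : ℝ) : E3 ≃ₗᵢ[ℝ] E3 :=
  LinearIsometry.toLinearIsometryEquiv ⟨planeRotation i j t, norm_planeRotation hij t⟩ rfl

theorem setIntegral_sphere_comp_planeRotation {i j : Fin 3} (hij : i ≠ j) (t : ℝ) (f : E3 → ℝ) :
    ∫ x in Metric.sphere (0 : E3) 1, f (planeRotation i j t x) ∂(μH[2]) =
      ∫ x in Metric.sphere (0 : E3) 1, f x ∂(μH[2]) := by
  let e := (planeRotationEquiv hij t).toIsometryEquiv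
  have hpre : e ⁻¹' Metric.sphere (0 : E3) 1 = Metric.sphere (0 : E3) 1 := by
    ext x
    have h : ‖e x‖ = ‖x‖ := norm_planeRotation hij t x
    rw [Set.mem_preimage, mem_sphere_zero_iff_norm, mem_sphere_zero_iff_norm, h]
  have h := (e.measurePreserving_hausdorffMeasure 2).setIntegral_preimage_emb
    e.toHomeomorph.measurableEmbedding f (Metric.sphere (0 : E3) 1)
  rwa [hpre] at h

/-- The generator `Xᵢ ∂ⱼ - Xⱼ ∂ᵢ` of the rotations in the plane of the coordinates `i` and `j`. -/
def angularDeriv (i j : Fin 3) (P : MvPolynomial (Fin 3) ℝ) : MvPolynomial (Fin 3) ℝ :=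
  X i * pderiv j P - X j * pderiv i P

theorem hasDerivAt_polyFun_planeRotation {i j : Fin 3} (hij : i ≠ j)
    (P : MvPolynomial (Fin 3) ℝ) (x : E3) (t : ℝ) :
    HasDerivAt (fun s => polyFun P (planeRotation i j s x))
      (polyFun (angularDeriv i j P) (planeRotation i j t x)) t := by
  have hR : HasDerivAt (fun s => planeRotation i j s x)
      (toE3 fun k => if k = i then -planeRotation i j t x j
        else if k = j then planeRotation i j t x i else 0) t := by
    refine (EuclideanSpace.equiv (Fin 3) ℝ).symm.toContinuousLinearMap.hasFDerivAt.comp_hasDerivAt t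
      (f := fun s k => planeRotation i j s x k) (hasDerivAt_pi.2 fun k => ?_)
    simp only [planeRotation_apply, hij.symm, if_true, if_false]
    split_ifs
    · convert! ((hasDerivAt_cos t).mul_const (x i)).sub ((hasDerivAt_sin t).mul_const (x j)) using 1
      ring
    · convert! ((hasDerivAt_sin t).mul_const (x i)).add ((hasDerivAt_cos t).mul_const (x j)) using 1
      ring
    · exact hasDerivAt_const _ _
  convert! (hasFDerivAt_polyFun P (planeRotation i j t x)).comp_hasDerivAt t hR using 1
  simp only [angularDeriv, polyFun, toE3, Fin.sum_univ_three]
  fin_cases i <;> fin_cases j <;> simp at hij ⊢ <;> ring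

theorem continuous_planeRotation (i j : Fin 3) (t : ℝ) : Continuous (planeRotation i j t) :=
  (planeRotation i j t).continuous_of_finiteDimensional

theorem integrableOn_polyFun_sphere (P : MvPolynomial (Fin 3) ℝ) :
    IntegrableOn (polyFun P) (Metric.sphere (0 : E3) 1) μH[2] := by
  have : IsFiniteMeasure ((μH[2] : Measure E3).restrict (Metric.sphere 0 1)) :=
    isFiniteMeasure_restrict.2 hausdorffMeasure_sphere_lt_top.ne
  obtain ⟨C, hC⟩ := (isCompact_sphere (0 : E3) 1).exists_bound_of_continuousOn
    (continuous_polyFun P).continuousOn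
  exact Integrable.of_bound (continuous_polyFun P).aestronglyMeasurable C
    ((ae_restrict_mem Metric.isClosed_sphere.measurableSet).mono hC)

theorem setIntegral_sphere_angularDeriv {i j : Fin 3} (hij : i ≠ j)
    (P : MvPolynomial (Fin 3) ℝ) :
    ∫ x in Metric.sphere (0 : E3) 1, polyFun (angularDeriv i j P) x ∂(μH[2]) = 0 := by
  have : IsFiniteMeasure ((μH[2] : Measure E3).restrict (Metric.sphere 0 1)) :=
    isFiniteMeasure_restrict.2 hausdorffMeasure_sphere_lt_top.ne
  obtain ⟨C, hC⟩ := (isCompact_sphere (0 : E3) 1).exists_bound_of_continuousOn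
    (continuous_polyFun (angularDeriv i j P)).continuousOn
  have hmeas (Q : MvPolynomial (Fin 3) ℝ) (t : ℝ) :
      AEStronglyMeasurable (fun x => polyFun Q (planeRotation i j t x))
        ((μH[2] : Measure E3).restrict (Metric.sphere 0 1)) :=
    ((continuous_polyFun Q).comp (continuous_planeRotation i j t)).aestronglyMeasurable
  have hderiv := (hasDerivAt_integral_of_dominated_loc_of_deriv_le
    (F := fun t x => polyFun P (planeRotation i j t x))
    (F' := fun t x => polyFun (angularDeriv i j P) (planeRotation i j t x))
    (x₀ := (0 : ℝ)) (bound := fun _ => C) Filter.univ_mem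
    (.of_forall (hmeas P))
    (by simpa only [planeRotation_zero] using! integrableOn_polyFun_sphere P)
    (hmeas _ 0)
    ((ae_restrict_mem Metric.isClosed_sphere.measurableSet).mono fun x hx t _ =>
      hC _ (by simpa [norm_planeRotation hij] using hx))
    (integrable_const C)
    (.of_forall fun x t _ => hasDerivAt_polyFun_planeRotation hij P x t)).2
  simp only [planeRotation_zero, setIntegral_sphere_comp_planeRotation hij] at hderiv
  exact hderiv.unique (hasDerivAt_const _ _)

theorem sum_mul_polyFun_pderiv {n : ℕ} {P : MvPolynomial (Fin 3) ℝ} (hP : P.IsHomogeneous n)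
    (x : E3) : ∑ i, x i * polyFun (pderiv i P) x = n * polyFun P x := by
  have h := congrArg (fun R => polyFun R x) hP.sum_X_mul_pderiv
  simpa [polyFun] using h

theorem inner_grad3_eq_angularDeriv {n : ℕ} (hn : 1 ≤ n) {P Q : MvPolynomial (Fin 3) ℝ}
    (hhomP : P.IsHomogeneous n) (hhomQ : Q.IsHomogeneous n)
    (hharmQ : ∀ x, lap3 (polyFun Q) x = 0) {x : E3} (hx : x ∈ Metric.sphere (0 : E3) 1) :
    ⟪grad3 (polyFun P) x, ((2 * (n : ℝ) + 1) * polyFun Q x) • x - grad3 (polyFun Q) x⟫ =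
      -(polyFun (angularDeriv 0 1 (P * angularDeriv 0 1 Q)) x +
        polyFun (angularDeriv 1 2 (P * angularDeriv 1 2 Q)) x +
        polyFun (angularDeriv 2 0 (P * angularDeriv 2 0 Q)) x) := by
  have hx1 := sum_sq_eq_one_of_mem_sphere hx
  have hP := sum_mul_polyFun_pderiv hhomP x
  have hQ := sum_mul_polyFun_pderiv hhomQ x
  have hQ' (i : Fin 3) := sum_mul_polyFun_pderiv (hhomQ.pderiv (i := i)) x
  have hlap := hharmQ x
  have hQ0 := hQ' 0
  have hQ1 := hQ' 1
  have hQ2 := hQ' 2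
  simp only [lap3, pd_polyFun, Fin.sum_univ_three, Nat.cast_sub hn, Nat.cast_one]
    at hP hQ hQ0 hQ1 hQ2 hlap
  rw [pderiv_pderiv_comm 1 0, pderiv_pderiv_comm 2 0] at hQ0
  rw [pderiv_pderiv_comm 2 1] at hQ1
  simp only [grad3, toE3, pd_polyFun, PiLp.inner_apply, Fin.sum_univ_three,
    WithLp.equiv_symm_apply, PiLp.sub_apply, PiLp.smul_apply, smul_eq_mul, RCLike.inner_apply,
    conj_trivial]
  simp only [angularDeriv, polyFun, pderiv_mul, map_sub, map_add, map_mul, eval_X, pderiv_X]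
    at hP hQ hQ0 hQ1 hQ2 hlap ⊢
  simp only [pderiv_pderiv_comm 1 0, pderiv_pderiv_comm 2 0, pderiv_pderiv_comm 2 1,
    Pi.single_apply, Fin.reduceEq, if_true, if_false, map_one, map_zero]
  set E := eval fun i => x i
  linear_combination
    (E (pderiv 0 P) * E (pderiv 0 Q) + E (pderiv 1 P) * E (pderiv 1 Q)
      + E (pderiv 2 P) * E (pderiv 2 Q)) * hx1
    + (n + 1) * E Q * hP
    - (x 0 * E (pderiv 0 P) + x 1 * E (pderiv 1 P) + x 2 * E (pderiv 2 P) + E P * (n + 1)) * hQ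
    + E P * (x 0 ^ 2 + x 1 ^ 2 + x 2 ^ 2) * hlap
    - E P * x 0 * hQ0 - E P * x 1 * hQ1 - E P * x 2 * hQ2

/-- for harmonic homogeneous polynomials `P, Q` of the same degree `n ≥ 1`,
`∫_{S²} ∇P(x) · ((2n+1) Q(x) x − ∇Q(x)) dσ(x) = 0`. -/
theorem M_orthogonal_N (n : ℕ) (hn : 1 ≤ n)
    (P Q : MvPolynomial (Fin 3) ℝ)
    (hhomP : P.IsHomogeneous n) (hharmP : ∀ x, lap3 (polyFun P) x = 0)
    (hhomQ : Q.IsHomogeneous n) (hharmQ : ∀ x, lap3 (polyFun Q) x = 0) :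
    ∫ x in Metric.sphere (0 : E3) 1,
        ⟪grad3 (polyFun P) x,
          ((2 * (n : ℝ) + 1) * polyFun Q x) • x - grad3 (polyFun Q) x⟫ ∂(μH[2]) = 0 := by
  have hint (i j : Fin 3) := integrableOn_polyFun_sphere (angularDeriv i j (P * angularDeriv i j Q))
  rw [setIntegral_congr_fun Metric.isClosed_sphere.measurableSet
    fun x hx => inner_grad3_eq_angularDeriv hn hhomP hhomQ hharmQ hx, integral_neg,
    integral_add (by exact (hint 0 1).add (hint 1 2)) (hint 2 0),
    integral_add (hint 0 1) (hint 1 2),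
    setIntegral_sphere_angularDeriv (by decide), setIntegral_sphere_angularDeriv (by decide),
    setIntegral_sphere_angularDeriv (by decide)]
  simp

end
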